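/- Let A be an arbitrary 2-index real array on n-dimensional Minkowski vector space with superenergy tensor T, and let ℓ be a null vector. Then T_{αβλμ}ℓ^λ = 0 for all α,β,μ if and only if A_{μν}ℓ_τ − A_{μτ}ℓ_ν = 0 for all μ,ν,τ. -/

import Mathlib

open Finset

noncomputable section

/-- Sign of the `i`-th diagonal entry of the Minkowski metric diag(-1,1,...,1). -/
def sgn {n : ℕ} (i : Fin n) : ℝ := if (i : ℕ) = 0 then -1 else 1

/-- The Minkowski metric components η_{ij} (= η^{ij}). -/
def eta {n : ℕ} (i j : Fin n) : ℝ := if i = j then sgn i else 0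

/-- Minkowski square η(v,v) of a vector. -/
def mSq {n : ℕ} (v : Fin n → ℝ) : ℝ := ∑ i, sgn i * v i * v i

/-- Lowered components v_i = η_{ij} v^j. -/
def lo {n : ℕ} (v : Fin n → ℝ) (i : Fin n) : ℝ := sgn i * v i

/-- The superenergy tensor of an arbitrary 2-index array A (no symmetries assumed). -/
def SE2 {n : ℕ} (A : Fin n → Fin n → ℝ) (a b l m : Fin n) : ℝ :=
  A a l * A b m + A b l * A a m
  - eta a b * (∑ r, sgn r * A r l * A r m)
  - eta l m * (∑ r, sgn r * A a r * A b r)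
  + (1/2) * eta a b * eta l m * (∑ r, ∑ s, sgn r * sgn s * A r s * A r s)

lemma sgn_mul_self {n : ℕ} (i : Fin n) : sgn i * sgn i = 1 := by
  unfold sgn; split_ifs <;> norm_num

lemma sgn_mul_sq_of_zero {n : ℕ} {x : Fin n → ℝ} (hx : ∀ i : Fin n, (i : ℕ) = 0 → x i = 0)
    (i : Fin n) : sgn i * x i * x i = x i ^ 2 := by
  unfold sgn
  split_ifs with h
  · simp [hx i h]
  · ring

/-- On vectors with vanishing time component the Minkowski square is nonnegative. -/
lemma mSq_nonneg_of_zero {n : ℕ} {x : Fin n → ℝ} (hx : ∀ i : Fin n, (i : ℕ) = 0 → x i = 0) :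
    0 ≤ mSq x := by
  unfold mSq
  simp only [sgn_mul_sq_of_zero hx]
  positivity

/-- On vectors with vanishing time component the Minkowski square is definite. -/
lemma eq_zero_of_mSq_eq_zero {n : ℕ} {x : Fin n → ℝ}
    (hx : ∀ i : Fin n, (i : ℕ) = 0 → x i = 0) (h : mSq x = 0) : x = 0 := by
  unfold mSq at h
  simp only [sgn_mul_sq_of_zero hx] at h
  rw [Finset.sum_eq_zero_iff_of_nonneg (fun i _ => sq_nonneg _)] at h
  funext i
  exact pow_eq_zero_iff two_ne_zero |>.mp (h i (Finset.mem_univ i))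

lemma sum_lo_mul_self {n : ℕ} (v : Fin n → ℝ) : ∑ i, lo v i * v i = mSq v := rfl

lemma mSq_lo {n : ℕ} (v : Fin n → ℝ) : mSq (lo v) = mSq v := by
  unfold mSq lo
  refine Finset.sum_congr rfl fun i _ => ?_
  linear_combination (sgn i * v i * v i) * sgn_mul_self i

/-- A nonzero null vector has nonzero time component. -/
lemma lo_ne_zero_of_null {n : ℕ} {v : Fin n → ℝ} (hv : v ≠ 0) (hnull : mSq v = 0) {z : Fin n}
    (hz : (z : ℕ) = 0) : lo v z ≠ 0 := by
  intro h
  refine hv (eq_zero_of_mSq_eq_zero (fun i hi => ?_) hnull)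
  obtain rfl : i = z := Fin.ext (hi.trans hz.symm)
  simpa [lo, sgn, hi] using h

/-- For a covector orthogonal to a null vector, the Minkowski square is that of its part
orthogonal to the time direction along the null vector. -/
lemma mSq_sub_of_orthogonal {n : ℕ} {v w : Fin n → ℝ} (hnull : mSq v = 0)
    (hw : ∑ i, w i * v i = 0) (z : Fin n) :
    mSq (fun i => w i * lo v z - w z * lo v i) = lo v z ^ 2 * mSq w := by
  have key : mSq (fun i => w i * lo v z - w z * lo v i)
      = lo v z ^ 2 * mSq w - 2 * w z * lo v z * ∑ i, w i * v i + w z ^ 2 * mSq (lo v) := by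
    unfold mSq
    simp only [Finset.mul_sum, ← Finset.sum_sub_distrib, ← Finset.sum_add_distrib]
    refine Finset.sum_congr rfl fun i _ => ?_
    have h : lo v i = sgn i * v i := rfl
    rw [h]
    linear_combination (-2 * w i * lo v z * w z * v i) * sgn_mul_self i
  rw [key, hw, mSq_lo, hnull]
  ring

lemma mSq_nonneg_of_orthogonal {n : ℕ} {v w : Fin n → ℝ} (hv : v ≠ 0) (hnull : mSq v = 0)
    (hw : ∑ i, w i * v i = 0) {z : Fin n} (hz : (z : ℕ) = 0) : 0 ≤ mSq w := by
  have h := mSq_sub_of_orthogonal hnull hw z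
  have h0 : 0 ≤ mSq (fun i => w i * lo v z - w z * lo v i) := by
    refine mSq_nonneg_of_zero fun i hi => ?_
    obtain rfl : i = z := Fin.ext (hi.trans hz.symm)
    ring
  rw [h] at h0
  have := lo_ne_zero_of_null hv hnull hz
  exact nonneg_of_mul_nonneg_right h0 (by positivity)

/-- A null covector orthogonal to a null vector is proportional to it. -/
lemma mul_lo_eq_of_orthogonal {n : ℕ} {v w : Fin n → ℝ} (hnull : mSq v = 0)
    (hw : ∑ i, w i * v i = 0) (hw0 : mSq w = 0) {z : Fin n} (hz : (z : ℕ) = 0) (i : Fin n) :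
    w i * lo v z = w z * lo v i := by
  have h := mSq_sub_of_orthogonal hnull hw z
  rw [hw0, mul_zero] at h
  have h0 := eq_zero_of_mSq_eq_zero (fun i hi => by
    obtain rfl : i = z := Fin.ext (hi.trans hz.symm)
    ring) h
  exact sub_eq_zero.mp (congrFun h0 i)

lemma sum_eta_mul {n : ℕ} (v : Fin n → ℝ) (m : Fin n) : ∑ l, eta l m * v l = lo v m := by
  simp [eta, lo]

/-- Contraction of the superenergy tensor with a vector in its third slot. -/
lemma sum_SE2_mul {n : ℕ} (A : Fin n → Fin n → ℝ) (v : Fin n → ℝ) (a b m : Fin n) :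
    ∑ l, SE2 A a b l m * v l =
      (∑ l, A a l * v l) * A b m + (∑ l, A b l * v l) * A a m
      - eta a b * (∑ r, sgn r * (∑ l, A r l * v l) * A r m)
      - lo v m * (∑ r, sgn r * A a r * A b r)
      + (1/2) * eta a b * lo v m * (∑ r, ∑ s, sgn r * sgn s * A r s * A r s) := by
  have hC : ∑ r, sgn r * (∑ l, A r l * v l) * A r m
      = ∑ l, (∑ r, sgn r * A r l * A r m) * v l := by
    simp only [Finset.mul_sum, Finset.sum_mul]
    rw [Finset.sum_comm]
    exact Finset.sum_congr rfl fun l _ => Finset.sum_congr rfl fun r _ => by ring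
  rw [hC, ← sum_eta_mul v m]
  simp only [SE2]
  generalize (∑ r, ∑ s, sgn r * sgn s * A r s * A r s) = S
  generalize (∑ r, sgn r * A a r * A b r) = B
  generalize hCl : (fun l => ∑ r, sgn r * A r l * A r m) = C
  have hCl' : ∀ l, ∑ r, sgn r * A r l * A r m = C l := fun l => congrFun hCl l
  simp only [hCl']
  simp only [Finset.mul_sum, Finset.sum_mul, ← Finset.sum_sub_distrib, ← Finset.sum_add_distrib]
  exact Finset.sum_congr rfl fun l _ => by ring

/-- A covector whose tensor square is a multiple of the metric vanishes in dimension at least 2. -/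
lemma eq_zero_of_mul_eq_eta {n : ℕ} (hn : 2 ≤ n) {c : Fin n → ℝ} {N : ℝ}
    (h : ∀ a b, c a * c b = eta a b * N) : c = 0 := by
  have hz := h ⟨0, by omega⟩ ⟨0, by omega⟩
  have h1 := h ⟨1, by omega⟩ ⟨1, by omega⟩
  simp [eta, sgn] at hz h1
  have hN : N = 0 := by
    nlinarith [mul_self_nonneg (c ⟨0, by omega⟩), mul_self_nonneg (c ⟨1, by omega⟩)]
  funext a
  have := h a a
  rw [hN, mul_zero] at this
  exact mul_self_eq_zero.mp this

/-- T_{αβλμ}ℓ^λ = 0 iff A_{μ[ν}ℓ_{τ]} = 0, for null ℓ. -/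
theorem stmt_19 {n : ℕ} (hn : 2 ≤ n) (A : Fin n → Fin n → ℝ)
    (ℓ : Fin n → ℝ) (hℓ0 : ℓ ≠ 0) (hnull : mSq ℓ = 0) :
    (∀ a b m : Fin n, ∑ l, SE2 A a b l m * ℓ l = 0) ↔
      (∀ m v t : Fin n, A m v * lo ℓ t - A m t * lo ℓ v = 0) := by
  have hz : ((⟨0, by omega⟩ : Fin n) : ℕ) = 0 := rfl
  generalize (⟨0, by omega⟩ : Fin n) = z at hz
  have hlz := lo_ne_zero_of_null hℓ0 hnull hz
  constructor
  · intro h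
    simp only [sum_SE2_mul] at h
    have hc : (fun a => ∑ l, A a l * ℓ l) = 0 := by
      refine eq_zero_of_mul_eq_eta hn
        (N := (1/2) * ∑ m, (∑ r, sgn r * (∑ l, A r l * ℓ l) * A r m) * ℓ m) fun a b => ?_
      have h1 : ∑ m, ((∑ l, A a l * ℓ l) * A b m + (∑ l, A b l * ℓ l) * A a m
          - eta a b * (∑ r, sgn r * (∑ l, A r l * ℓ l) * A r m)
          - lo ℓ m * (∑ r, sgn r * A a r * A b r)
          + (1/2) * eta a b * lo ℓ m * (∑ r, ∑ s, sgn r * sgn s * A r s * A r s)) * ℓ m = 0 :=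
        Finset.sum_eq_zero fun m _ => by rw [h a b m, zero_mul]
      generalize (∑ r, ∑ s, sgn r * sgn s * A r s * A r s) = S at h1
      generalize (∑ r, sgn r * A a r * A b r) = B at h1
      generalize hC : (fun m => ∑ r, sgn r * (∑ l, A r l * ℓ l) * A r m) = C
      have hC' : ∀ m, ∑ r, sgn r * (∑ l, A r l * ℓ l) * A r m = C m := fun m => congrFun hC m
      simp only [hC'] at h1 ⊢
      generalize hca : ∑ l, A a l * ℓ l = ca at h1 ⊢
      generalize hcb : ∑ l, A b l * ℓ l = cb at h1 ⊢
      have h2 : ∑ m, (ca * A b m + cb * A a m - eta a b * C m - lo ℓ m * B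
            + (1/2) * eta a b * lo ℓ m * S) * ℓ m
          = ca * (∑ m, A b m * ℓ m) + cb * (∑ m, A a m * ℓ m) - eta a b * (∑ m, C m * ℓ m)
            + ((1/2) * eta a b * S - B) * ∑ m, lo ℓ m * ℓ m := by
        simp only [Finset.mul_sum, ← Finset.sum_sub_distrib, ← Finset.sum_add_distrib]
        exact Finset.sum_congr rfl fun m _ => by ring
      rw [h1, hca, hcb, sum_lo_mul_self, hnull] at h2
      linarith
    have hc' : ∀ a, ∑ l, A a l * ℓ l = 0 := fun a => congrFun hc a
    simp only [hc'] at h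
    generalize (∑ r, ∑ s, sgn r * sgn s * A r s * A r s) = S at h
    have hB : ∀ a, mSq (A a) = (1/2) * sgn a * S := by
      intro a
      have h1 := h a a z
      simp only [zero_mul, mul_zero, Finset.sum_const_zero, eta, if_true] at h1
      apply mul_left_cancel₀ hlz
      change lo ℓ z * (∑ r, sgn r * A a r * A a r) = _
      linarith
    have hnn : ∀ a, 0 ≤ mSq (A a) := fun a => mSq_nonneg_of_orthogonal hℓ0 hnull (hc' a) hz
    have hS : S = 0 := by
      have h0 := hnn z
      have h1 := hnn ⟨1, by omega⟩
      rw [hB] at h0 h1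
      simp [sgn, hz] at h0 h1
      linarith
    intro m v t
    have hp := mul_lo_eq_of_orthogonal hnull (hc' m) (by rw [hB, hS, mul_zero]) hz
    apply mul_left_cancel₀ hlz
    linear_combination lo ℓ t * hp v - lo ℓ v * hp t
  · intro h a b m
    obtain ⟨u, hu⟩ : ∃ u : Fin n → ℝ, ∀ m v, A m v = u m * lo ℓ v := by
      refine ⟨fun m => A m z / lo ℓ z, fun m v => ?_⟩
      field_simp
      linarith [h m v z]
    have hc : ∀ a, ∑ l, A a l * ℓ l = 0 := fun a => by
      simp only [hu, mul_assoc, ← Finset.mul_sum]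
      rw [sum_lo_mul_self, hnull, mul_zero]
    have hB : ∀ a b, ∑ r, sgn r * A a r * A b r = 0 := fun a b => by
      have : ∑ r, sgn r * A a r * A b r = u a * u b * mSq (lo ℓ) := by
        unfold mSq
        rw [Finset.mul_sum]
        exact Finset.sum_congr rfl fun r _ => by rw [hu, hu]; ring
      rw [this, mSq_lo, hnull, mul_zero]
    have hS : ∑ r, ∑ s, sgn r * sgn s * A r s * A r s = 0 :=
      Finset.sum_eq_zero fun r _ => by
        simp only [mul_assoc, ← Finset.mul_sum]
        simpa only [mul_assoc, mul_zero] using congrArg (sgn r * ·) (hB r r)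
    rw [sum_SE2_mul, hS, hB]
    simp [hc]
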